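/- Polishness of the refined topology on an α-set: Let x ∈ X and let α ≥ 1 be a countable ordinal. Then the set B_α(x,∅) equipped with the topology t^x_α generated by the family {B ∩ B_α(x,∅) : B ∈ 𝓑^x_{<α}} as basic open sets is a Polish space, and the restricted action of G on B_α(x,∅) is continuous with respect to t^x_α (so B_α(x,∅) with t^x_α is a Polish G-space). -/

import Mathlib

open Set Pointwise

noncomputable section

/-- `S_∞`, the group of all permutations of `ℕ`. -/
abbrev Sinf : Type := Equiv.Perm ℕ

/-- The topology of pointwise convergence on `S_∞`. -/
instance SinfTopology : TopologicalSpace Sinf :=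
  TopologicalSpace.induced (fun g : Sinf => (g : ℕ → ℕ)) Pi.topologicalSpace

/-- The graph of the restriction of a permutation `g` to a finite set `d`. -/
def restr (g : Sinf) (d : Finset ℕ) : Set (ℕ × ℕ) := {p | p.1 ∈ d ∧ g p.1 = p.2}

/-- The domain of a partial map coded by its graph. -/
def pdom (σ : Set (ℕ × ℕ)) : Set ℕ := Prod.fst '' σ

/-- The range of a partial map coded by its graph. -/
def prng (σ : Set (ℕ × ℕ)) : Set ℕ := Prod.snd '' σ

/-- `S^G_{<∞}`: graphs of restrictions of elements of `G` to finite subsets of `ℕ`. -/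
def SGfin (G : Subgroup Sinf) : Set (Set (ℕ × ℕ)) :=
  {σ | ∃ g ∈ G, ∃ d : Finset ℕ, σ = restr g d}

/-- `V^G_σ`: the elements of `G` extending the partial bijection `σ`. -/
def Vb (G : Subgroup Sinf) (σ : Set (ℕ × ℕ)) : Set G :=
  {g : G | ∀ p ∈ σ, (g : Sinf) p.1 = p.2}

/-- `V^G_c`: the pointwise stabilizer of `c ⊆ ℕ` in `G`. -/
def Vc (G : Subgroup Sinf) (c : Set ℕ) : Set G :=
  {g : G | ∀ k ∈ c, (g : Sinf) k = k}

/-- The identity partial bijection on `c`. -/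
def idb (c : Set ℕ) : Set (ℕ × ℕ) := {p | p.1 ∈ c ∧ p.2 = p.1}

/-- The composition `σ ∘ f`, restricted to `f⁻¹[dom σ]`. -/
def compR (σ : Set (ℕ × ℕ)) (f : Sinf) : Set (ℕ × ℕ) := {p | (f p.1, p.2) ∈ σ}

/-- The composition `f ∘ σ`. -/
def compL (f : Sinf) (σ : Set (ℕ × ℕ)) : Set (ℕ × ℕ) := {p | (p.1, f⁻¹ p.2) ∈ σ}

/-- The Borel classes `Σ⁰_α(X)`: `Σ⁰_1(X)` consists of the open sets, and for `α > 1`,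
`Σ⁰_α(X)` consists of countable unions of sets whose complements lie in
`⋃_{1 ≤ β < α} Σ⁰_β(X)` (i.e. of sets from `⋃_{1 ≤ β < α} Π⁰_β(X)`). -/
def SigmaB (X : Type*) [TopologicalSpace X] (α : Ordinal.{0}) : Set (Set X) :=
  if α ≤ 1 then {s | IsOpen s}
  else {s | ∃ f : ℕ → Set X,
      (∀ n, ∃ β : {γ : Ordinal.{0} // γ < α}, 1 ≤ β.1 ∧ (f n)ᶜ ∈ SigmaB X β.1) ∧
      s = ⋃ n, f n}
termination_by α
decreasing_by exact β.2

/-- The Borel classes `Π⁰_α(X)`: complements of sets in `Σ⁰_α(X)`. -/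
def PiB (X : Type*) [TopologicalSpace X] (α : Ordinal.{0}) : Set (Set X) :=
  {s | sᶜ ∈ SigmaB X α}

section Action

variable (G : Subgroup Sinf) {X : Type*} [TopologicalSpace X] [MulAction G X]

/-- The image `S • x` of a point under a set of group elements. -/
def setOrb (S : Set G) (x : X) : Set X := (fun g : G => g • x) '' S

/-- The image `S • B` of a set under a set of group elements. -/
def setSmul (S : Set G) (B : Set X) : Set X := ⋃ g ∈ S, g • B

/-- The `1`-sets `B₁(x, σ)`. -/
def BsetOne (A : ℕ → Set X) (σ : Set (ℕ × ℕ)) (x : X) : Set X :=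
  (⋂ l, ⋂ (_ : (setOrb G (Vb G σ) x ∩ A l).Nonempty), setSmul G (Vc G (prng σ)) (A l)) ∩
    (⋂ l, ⋂ (_ : setOrb G (Vb G σ) x ∩ A l = ∅), (setSmul G (Vc G (prng σ)) (A l))ᶜ)

/-- The successor step of the recursion defining the `α`-sets. -/
def BsetSucc (prev : Set (ℕ × ℕ) → X → Set X) (σ : Set (ℕ × ℕ)) (x : X) : Set X :=
  (⋂ b : Finset ℕ, ⋂ (_ : pdom σ ⊆ ↑b),
      ⋃ σ' ∈ SGfin G, ⋃ (_ : σ ⊆ σ') (_ : pdom σ' = ↑b), prev σ' x) ∩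
    (⋂ a : Finset ℕ, ⋂ (_ : prng σ ⊆ ↑a),
      ⋃ σ' ∈ SGfin G, ⋃ (_ : σ ⊆ σ') (_ : prng σ' = ↑a), prev σ' x)

/-- The `α`-sets `B_α(x, σ)`, for `α ≥ 1` (the value at `α = 0` is junk). -/
def Bset (A : ℕ → Set X) (α : Ordinal.{0}) : Set (ℕ × ℕ) → X → Set X :=
  @Ordinal.limitRecOn (fun _ => Set (ℕ × ℕ) → X → Set X) α
    (fun _ _ => univ)
    (fun o ih => if o = 0 then BsetOne G A else BsetSucc G ih)
    (fun o _ ih σ x => ⋂ β : Ordinal.{0}, ⋂ (hβ : β < o), ⋂ (_ : 1 ≤ β), ih β hβ σ x)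

/-- The family `𝓑^x_{<α}` consisting of the basic open sets together with all
`β`-sets of `x` for `1 ≤ β < α`. -/
def BltFam (A : ℕ → Set X) (x : X) (α : Ordinal.{0}) : Set (Set X) :=
  {B | (∃ l, B = A l) ∨
    ∃ β : Ordinal.{0}, 1 ≤ β ∧ β < α ∧ ∃ σ ∈ SGfin G, B = Bset G A β σ x}

/-- `γ^G_*(x)`: the least countable ordinal `γ` such that for all `σ, δ ∈ S^G_{<∞}`
with equal ranges, if `B_α(x,σ) ≠ B_α(x,δ)` for some countable ordinal `α ≥ 1`,
then already `B_γ(x,σ) ≠ B_γ(x,δ)`. -/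
def gammaStar (A : ℕ → Set X) (x : X) : Ordinal :=
  sInf {γ : Ordinal.{0} | γ.card ≤ Cardinal.aleph0 ∧
    ∀ σ ∈ SGfin G, ∀ δ ∈ SGfin G, prng σ = prng δ →
      (∃ α : Ordinal.{0}, 1 ≤ α ∧ α.card ≤ Cardinal.aleph0 ∧
        Bset G A α σ x ≠ Bset G A α δ x) →
      Bset G A γ σ x ≠ Bset G A γ δ x}

end Action

/-- The topology on a subset `S ⊆ X` generated by the traces on `S` of the members
of the family `F`. -/
def traceTop {X : Type*} (S : Set X) (F : Set (Set X)) : TopologicalSpace S :=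
  TopologicalSpace.generateFrom {u : Set S | ∃ B ∈ F, u = Subtype.val ⁻¹' B}

/-- The space of closed subsets of `Y`. -/
def EffrosSpace (Y : Type*) [TopologicalSpace Y] := {K : Set Y // IsClosed K}

/-- The Effros Borel structure on the space of closed subsets of `Y`. -/
def effrosSigma (Y : Type*) [TopologicalSpace Y] : MeasurableSpace (EffrosSpace Y) :=
  MeasurableSpace.generateFrom
    {S | ∃ U : Set Y, IsOpen U ∧ S = {K : EffrosSpace Y | (K.1 ∩ U).Nonempty}}

section Proof

theorem Bset_one {G : Subgroup Sinf} {X : Type*} [TopologicalSpace X] [MulAction G X]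
    (A : ℕ → Set X) : Bset G A 1 = BsetOne G A := by
  have := @Ordinal.limitRecOn_add_one (fun _ => Set (ℕ × ℕ) → X → Set X) 0 (fun _ _ => univ)
    (fun o ih => if o = 0 then BsetOne G A else BsetSucc G ih)
    (fun o _ ih σ x => ⋂ β : Ordinal.{0}, ⋂ (hβ : β < o), ⋂ (_ : 1 ≤ β), ih β hβ σ x)
  simpa [Bset] using this

theorem Bset_succ {G : Subgroup Sinf} {X : Type*} [TopologicalSpace X] [MulAction G X]
    (A : ℕ → Set X) (β : Ordinal.{0}) (hβ : 1 ≤ β) :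
    Bset G A (β + 1) = BsetSucc G (Bset G A β) := by
  have h0 : β ≠ 0 := by
    rintro rfl
    simp at hβ
  unfold Bset
  rw [Ordinal.limitRecOn_add_one, if_neg h0]

theorem Bset_limit {G : Subgroup Sinf} {X : Type*} [TopologicalSpace X] [MulAction G X]
    (A : ℕ → Set X) (β : Ordinal.{0}) (hβ : Order.IsSuccLimit β) (σ : Set (ℕ × ℕ)) (x : X) :
    Bset G A β σ x = ⋂ γ : Ordinal.{0}, ⋂ (_ : γ < β), ⋂ (_ : 1 ≤ γ), Bset G A γ σ x := by
  unfold Bset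
  rw [Ordinal.limitRecOn_limit (h := hβ)]

theorem ord_ind {P : Ordinal.{0} → Prop} (h1 : P 1) (hs : ∀ β, 1 ≤ β → P β → P (β + 1))
    (hl : ∀ β, Order.IsSuccLimit β → (∀ γ, 1 ≤ γ → γ < β → P γ) → P β) :
    ∀ β, 1 ≤ β → P β := by
  intro β
  induction β using Ordinal.limitRecOn with
  | zero => intro h; simp at h
  | add_one o ih =>
    intro _
    by_cases h : o = 0
    · subst h; simpa using h1
    · have := Order.one_le_iff_pos.2 (pos_iff_ne_zero.2 h)
      exact hs o this (ih this)
  | limit o ho ih =>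
    intro _
    exact hl o ho (fun γ h1 h2 => ih γ h2 h1)

theorem pdom_restr (g : Sinf) (d : Finset ℕ) : pdom (restr g d) = ↑d := by
  ext k; simp [pdom, restr]

theorem prng_restr (g : Sinf) (d : Finset ℕ) : prng (restr g d) = g '' ↑d := by
  ext k; simp only [prng, restr, mem_image, Prod.exists, exists_eq_right]; rfl

theorem compL_restr (f g : Sinf) (d : Finset ℕ) : compL f (restr g d) = restr (f * g) d := by
  ext ⟨a, b⟩
  change (a ∈ d ∧ g a = f⁻¹ b) ↔ (a ∈ d ∧ f (g a) = b)
  rw [Equiv.Perm.eq_inv_iff_eq]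

theorem compL_mem {G : Subgroup Sinf} {f : Sinf} (hf : f ∈ G) {σ : Set (ℕ × ℕ)}
    (hσ : σ ∈ SGfin G) : compL f σ ∈ SGfin G := by
  obtain ⟨g, hg, d, rfl⟩ := hσ
  exact ⟨f * g, G.mul_mem hf hg, d, compL_restr f g d⟩

theorem compL_mono (f : Sinf) {σ τ : Set (ℕ × ℕ)} (h : σ ⊆ τ) : compL f σ ⊆ compL f τ :=
  fun _ hp => h hp

theorem pdom_compL (f : Sinf) (σ : Set (ℕ × ℕ)) : pdom (compL f σ) = pdom σ := by
  ext k
  simp only [pdom, compL, mem_image, Prod.exists, exists_and_right, exists_eq_right]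
  constructor
  · rintro ⟨b, h⟩; exact ⟨_, h⟩
  · rintro ⟨b, h⟩; exact ⟨f b, by simpa using h⟩

theorem prng_compL (f : Sinf) (σ : Set (ℕ × ℕ)) : prng (compL f σ) = f '' prng σ := by
  ext k
  simp only [prng, compL, mem_image, Prod.exists, exists_eq_right]
  constructor
  · rintro ⟨a, h⟩; exact ⟨_, ⟨a, h⟩, by simp⟩
  · rintro ⟨b, ⟨a, h⟩, rfl⟩; exact ⟨a, by simpa using h⟩

theorem compL_inv (f : Sinf) (σ : Set (ℕ × ℕ)) : compL f⁻¹ (compL f σ) = σ := by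
  ext ⟨a, b⟩; simp [compL]

theorem compL_congr {f g : Sinf} {σ : Set (ℕ × ℕ)} (h : ∀ k ∈ prng σ, f k = g k) :
    compL f σ = compL g σ := by
  ext ⟨a, b⟩
  change (a, f⁻¹ b) ∈ σ ↔ (a, g⁻¹ b) ∈ σ
  constructor
  · intro hm
    have := h _ ⟨_, hm, rfl⟩
    simp at this
    have h2 : g⁻¹ b = f⁻¹ b := by rw [Equiv.Perm.inv_eq_iff_eq]; simpa using this
    rwa [h2]
  · intro hm
    have := h _ ⟨_, hm, rfl⟩
    simp at this
    have h2 : f⁻¹ b = g⁻¹ b := by rw [Equiv.Perm.inv_eq_iff_eq]; simpa using this.symm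
    rwa [h2]

theorem compL_one (σ : Set (ℕ × ℕ)) : compL 1 σ = σ := by
  ext ⟨a, b⟩; simp [compL]

theorem SGfin_countable (G : Subgroup Sinf) : (SGfin G).Countable := by
  have : SGfin G ⊆ range (fun s : Finset (ℕ × ℕ) => (s : Set (ℕ × ℕ))) := by
    rintro σ ⟨g, hg, d, rfl⟩
    refine ⟨d.image (fun k => (k, g k)), ?_⟩
    ext ⟨a, b⟩
    simp [restr]
  exact (countable_range _).mono this

theorem SGfin_fin_dom {G : Subgroup Sinf} {σ : Set (ℕ × ℕ)} (h : σ ∈ SGfin G) :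
    ∃ d : Finset ℕ, pdom σ = ↑d := by
  obtain ⟨g, hg, d, rfl⟩ := h
  exact ⟨d, pdom_restr g d⟩

theorem SGfin_fin_rng {G : Subgroup Sinf} {σ : Set (ℕ × ℕ)} (h : σ ∈ SGfin G) :
    ∃ d : Finset ℕ, prng σ = ↑d := by
  obtain ⟨g, hg, d, rfl⟩ := h
  exact ⟨d.image g, by rw [prng_restr]; simp⟩

theorem SGfin_eq_of_dom {G : Subgroup Sinf} {σ τ : Set (ℕ × ℕ)} (hτ : τ ∈ SGfin G)
    (hst : σ ⊆ τ) (h : pdom τ = pdom σ) : τ = σ := by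
  refine Subset.antisymm ?_ hst
  obtain ⟨g, hg, d, rfl⟩ := hτ
  rintro ⟨a, b⟩ hp
  have : a ∈ pdom σ := h ▸ ⟨_, hp, rfl⟩
  obtain ⟨⟨a', b'⟩, hq, rfl⟩ := this
  have h1 := (hst hq).2
  have h2 := hp.2
  simp only at h1 h2
  rw [← h2, h1]
  exact hq

theorem SGfin_transfer {G : Subgroup Sinf} {σ τ τ' : Set (ℕ × ℕ)} (hτ : τ ∈ SGfin G)
    (hτ' : τ' ∈ SGfin G) (h : pdom τ = pdom τ') (h1 : σ ⊆ τ) (h2 : σ ⊆ τ') :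
    ∃ f ∈ G, compL f τ = τ' ∧ ∀ k ∈ prng σ, f k = k := by
  obtain ⟨g, hg, d, rfl⟩ := hτ
  obtain ⟨g', hg', d', rfl⟩ := hτ'
  rw [pdom_restr, pdom_restr, Finset.coe_inj] at h
  subst h
  refine ⟨g' * g⁻¹, G.mul_mem hg' (G.inv_mem hg), by rw [compL_restr]; simp, ?_⟩
  rintro k ⟨⟨a, b⟩, hp, rfl⟩
  have e1 := (h1 hp).2
  have e2 := (h2 hp).2
  simp only at e1 e2
  simp only [Equiv.Perm.mul_apply]
  have e3 : g⁻¹ b = a := by rw [Equiv.Perm.inv_eq_iff_eq, e1]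
  rw [e3, e2]

section

variable {G : Subgroup Sinf} {X : Type*} [TopologicalSpace X] [MulAction G X] {A : ℕ → Set X}

theorem mem_setSmul_Vc (c : Set ℕ) (U : Set X) (y : X) :
    y ∈ setSmul G (Vc G c) U ↔ ∃ g ∈ Vc G c, g • y ∈ U := by
  simp only [setSmul, mem_iUnion, mem_smul_set_iff_inv_smul_mem, exists_prop]
  have key : ∀ g ∈ Vc G c, g⁻¹ ∈ Vc G c := by
    intro g hg k hk
    have := hg k hk
    simp only [Subgroup.coe_inv]
    rw [Equiv.Perm.inv_eq_iff_eq, this]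
  constructor
  · rintro ⟨g, hg, h⟩
    exact ⟨g⁻¹, key g hg, h⟩
  · rintro ⟨g, hg, h⟩
    exact ⟨g⁻¹, key g hg, by simpa using h⟩

theorem mem_one_iff (σ : Set (ℕ × ℕ)) (x y : X) :
    y ∈ Bset G A 1 σ x ↔ ∀ l, (∃ g ∈ Vb G σ, g • x ∈ A l) ↔
      ∃ g ∈ Vc G (prng σ), g • y ∈ A l := by
  rw [Bset_one]
  simp only [BsetOne, mem_inter_iff, mem_iInter, mem_compl_iff, mem_setSmul_Vc,
    ← not_nonempty_iff_eq_empty]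
  have : ∀ l, (setOrb G (Vb G σ) x ∩ A l).Nonempty ↔ ∃ g ∈ Vb G σ, g • x ∈ A l := by
    intro l
    constructor
    · rintro ⟨_, ⟨g, hg, rfl⟩, h⟩; exact ⟨g, hg, h⟩
    · rintro ⟨g, hg, h⟩; exact ⟨_, ⟨g, hg, rfl⟩, h⟩
  simp only [this]
  constructor
  · rintro ⟨h1, h2⟩ l
    exact ⟨h1 l, fun h => by_contra fun h' => h2 l h' h⟩
  · intro h
    exact ⟨fun l => (h l).1, fun l h' h'' => h' ((h l).2 h'')⟩

theorem mem_one_iff_open (hbasis : TopologicalSpace.IsTopologicalBasis (Set.range A))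
    (σ : Set (ℕ × ℕ)) (x y : X) :
    y ∈ Bset G A 1 σ x ↔ ∀ U, IsOpen U → ((∃ g ∈ Vb G σ, g • x ∈ U) ↔
      ∃ g ∈ Vc G (prng σ), g • y ∈ U) := by
  rw [mem_one_iff]
  constructor
  · intro h U hU
    constructor
    · rintro ⟨g, hg, hx⟩
      obtain ⟨_, ⟨l, rfl⟩, h1, h2⟩ := hbasis.exists_subset_of_mem_open hx hU
      obtain ⟨g', hg', h'⟩ := (h l).1 ⟨g, hg, h1⟩
      exact ⟨g', hg', h2 h'⟩
    · rintro ⟨g, hg, hx⟩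
      obtain ⟨_, ⟨l, rfl⟩, h1, h2⟩ := hbasis.exists_subset_of_mem_open hx hU
      obtain ⟨g', hg', h'⟩ := (h l).2 ⟨g, hg, h1⟩
      exact ⟨g', hg', h2 h'⟩
  · intro h l
    exact h _ (hbasis.isOpen ⟨l, rfl⟩)

theorem mem_succ_iff (β : Ordinal.{0}) (hβ : 1 ≤ β) (σ : Set (ℕ × ℕ)) (x y : X) :
    y ∈ Bset G A (β + 1) σ x ↔
      (∀ b : Finset ℕ, pdom σ ⊆ ↑b → ∃ σ' ∈ SGfin G, σ ⊆ σ' ∧ pdom σ' = ↑b ∧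
        y ∈ Bset G A β σ' x) ∧
      (∀ b : Finset ℕ, prng σ ⊆ ↑b → ∃ σ' ∈ SGfin G, σ ⊆ σ' ∧ prng σ' = ↑b ∧
        y ∈ Bset G A β σ' x) := by
  rw [Bset_succ A β hβ]
  simp only [BsetSucc, mem_inter_iff, mem_iInter, mem_iUnion, exists_prop]

theorem mem_limit_iff (β : Ordinal.{0}) (hβ : Order.IsSuccLimit β) (σ : Set (ℕ × ℕ)) (x y : X) :
    y ∈ Bset G A β σ x ↔ ∀ γ, γ < β → 1 ≤ γ → y ∈ Bset G A γ σ x := by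
  rw [Bset_limit A β hβ]
  simp only [mem_iInter]

theorem Bset_mono {σ : Set (ℕ × ℕ)} (hσ : σ ∈ SGfin G) (x : X) {γ : Ordinal.{0}} (hγ : 1 ≤ γ) :
    ∀ β, 1 ≤ β → γ ≤ β → Bset G A β σ x ⊆ Bset G A γ σ x := by
  apply ord_ind
  · intro h
    rw [le_antisymm h hγ]
  · intro β hβ ih h
    rcases h.eq_or_lt with rfl | h
    · exact Subset.rfl
    · refine Subset.trans ?_ (ih (Order.lt_add_one_iff.1 h))
      intro y hy
      rw [mem_succ_iff β hβ] at hy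
      obtain ⟨d, hd⟩ := SGfin_fin_dom hσ
      obtain ⟨σ', h1, h2, h3, h4⟩ := hy.1 d hd.subset
      rwa [SGfin_eq_of_dom h1 h2 (h3.trans hd.symm)] at h4
  · intro β hβ _ h
    rcases h.eq_or_lt with rfl | h
    · exact Subset.rfl
    · intro y hy
      exact (mem_limit_iff β hβ σ x y).1 hy γ h hγ

variable [ContinuousSMul G X]

theorem Bset_smul (hbasis : TopologicalSpace.IsTopologicalBasis (Set.range A)) (x : X) :
    ∀ β, 1 ≤ β → ∀ (f : G) (σ : Set (ℕ × ℕ)) (y : X), y ∈ Bset G A β σ x →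
      f • y ∈ Bset G A β (compL f σ) x := by
  apply ord_ind
  · intro f σ y hy
    rw [mem_one_iff_open hbasis] at hy ⊢
    intro U hU
    have hU' : IsOpen ((fun z : X => f • z) ⁻¹' U) := hU.preimage (continuous_const_smul f)
    have := hy _ hU'
    simp only [mem_preimage] at this
    have e1 : (∃ g ∈ Vb G (compL f σ), g • x ∈ U) ↔ ∃ g ∈ Vb G σ, f • g • x ∈ U := by
      constructor
      · rintro ⟨g, hg, h⟩
        refine ⟨f⁻¹ * g, ?_, by simpa [mul_smul] using h⟩
        rintro ⟨a, b⟩ hp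
        have := hg (a, (f : Sinf) b) (by simpa [compL] using hp)
        simp at this
        simp [this]
      · rintro ⟨g, hg, h⟩
        refine ⟨f * g, ?_, by simpa [mul_smul] using h⟩
        rintro ⟨a, b⟩ hp
        have := hg _ hp
        simp at this
        simp [this]
    have e2 : (∃ g ∈ Vc G (prng (compL f σ)), g • f • y ∈ U) ↔
        ∃ g ∈ Vc G (prng σ), f • g • y ∈ U := by
      rw [prng_compL]
      constructor
      · rintro ⟨g, hg, h⟩
        refine ⟨f⁻¹ * g * f, ?_, by simpa [mul_smul] using h⟩
        intro k hk
        have := hg _ ⟨k, hk, rfl⟩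
        simp [this]
      · rintro ⟨g, hg, h⟩
        refine ⟨f * g * f⁻¹, ?_, by simpa [mul_smul] using h⟩
        rintro _ ⟨k, hk, rfl⟩
        have := hg k hk
        simp [this]
    rw [e1, e2, this]
  · intro β hβ ih f σ y hy
    rw [mem_succ_iff β hβ] at hy ⊢
    constructor
    · intro b hb
      rw [pdom_compL] at hb
      obtain ⟨σ', h1, h2, h3, h4⟩ := hy.1 b hb
      exact ⟨compL f σ', compL_mem f.2 h1, compL_mono _ h2, by rw [pdom_compL, h3], ih f _ _ h4⟩
    · intro b hb
      rw [prng_compL] at hb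
      obtain ⟨σ', h1, h2, h3, h4⟩ := hy.2 (b.image ((f : Sinf)⁻¹ : Sinf)) (by
        intro k hk
        have := hb ⟨k, hk, rfl⟩
        simp only [Finset.coe_image, mem_image]
        exact ⟨_, this, by simp⟩)
      refine ⟨compL f σ', compL_mem f.2 h1, compL_mono _ h2, ?_, ih f _ _ h4⟩
      rw [prng_compL, h3, Finset.coe_image, image_image]
      simp
  · intro β hβ ih f σ y hy
    rw [mem_limit_iff β hβ] at hy ⊢
    intro γ h1 h2
    exact ih γ h2 h1 f σ y (hy γ h1 h2)

theorem Bset_smul_iff (hbasis : TopologicalSpace.IsTopologicalBasis (Set.range A)) (x : X)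
    (β : Ordinal.{0}) (hβ : 1 ≤ β) (f : G) (σ : Set (ℕ × ℕ)) (y : X) :
    f • y ∈ Bset G A β (compL f σ) x ↔ y ∈ Bset G A β σ x := by
  refine ⟨fun h => ?_, Bset_smul hbasis x β hβ f σ y⟩
  have := Bset_smul hbasis x β hβ f⁻¹ _ _ h
  simpa [compL_inv] using this

/-- `β`-sets with the same range are equal or disjoint. -/
theorem Bset_sub (hbasis : TopologicalSpace.IsTopologicalBasis (Set.range A)) (x : X) :
    ∀ β, 1 ≤ β → ∀ σ σ' : Set (ℕ × ℕ), prng σ = prng σ' → ∀ y, y ∈ Bset G A β σ x →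
      y ∈ Bset G A β σ' x → Bset G A β σ x ⊆ Bset G A β σ' x := by
  apply ord_ind
  · intro σ σ' hr y hy hy' z hz
    rw [mem_one_iff] at *
    intro l
    rw [hy' l, ← hr, ← hy l, hz l]
  · intro β hβ ih
    have ih' : ∀ σ σ' : Set (ℕ × ℕ), prng σ = prng σ' → ∀ y, y ∈ Bset G A β σ x →
      y ∈ Bset G A β σ' x → Bset G A β σ x = Bset G A β σ' x := fun σ σ' hr y h h' =>
        Subset.antisymm (ih σ σ' hr y h h') (ih σ' σ hr.symm y h' h)
    have push : ∀ (σ σ' τ τ' ρ : Set (ℕ × ℕ)), prng σ = prng σ' → σ ⊆ τ → σ ⊆ τ' → σ' ⊆ ρ →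
        τ ∈ SGfin G → τ' ∈ SGfin G → ρ ∈ SGfin G → pdom τ = pdom τ' → prng τ = prng ρ →
        ∀ y z, y ∈ Bset G A β τ x → y ∈ Bset G A β ρ x → z ∈ Bset G A β τ' x →
        ∃ ρ' ∈ SGfin G, σ' ⊆ ρ' ∧ pdom ρ' = pdom ρ ∧ prng ρ' = prng τ' ∧
          z ∈ Bset G A β ρ' x := by
      intro σ σ' τ τ' ρ hr hτ hτ' hρ mτ mτ' mρ hd hrr y z hy hy' hz
      obtain ⟨f, hf, h1, h2⟩ := SGfin_transfer mτ mτ' hd hτ hτ'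
      refine ⟨compL f ρ, compL_mem hf mρ, ?_, pdom_compL f ρ, ?_, ?_⟩
      · have := compL_mono f hρ
        rwa [compL_congr (g := 1) (by simpa [← hr] using h2), compL_one] at this
      · rw [prng_compL, ← hrr, ← prng_compL, h1]
      · have e := ih' τ ρ hrr y hy hy'
        rw [← h1] at hz
        have h3 := (Bset_smul_iff hbasis x β hβ ⟨f, hf⟩ τ
          ((⟨f, hf⟩ : G)⁻¹ • z)).1 (by simpa using hz)
        rw [e] at h3
        simpa using (Bset_smul_iff hbasis x β hβ ⟨f, hf⟩ ρ ((⟨f, hf⟩ : G)⁻¹ • z)).2 h3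
    intro σ σ' hr y hy hy' z hz
    rw [mem_succ_iff β hβ] at *
    constructor
    · intro b hb
      obtain ⟨ρ, mρ, h1, h2, h3⟩ := hy'.1 b hb
      obtain ⟨a, ha⟩ := SGfin_fin_rng mρ
      obtain ⟨τ, mτ, k1, k2, k3⟩ := hy.2 a (by
        rw [← ha, hr]; exact image_mono h1)
      obtain ⟨d, hd⟩ := SGfin_fin_dom mτ
      obtain ⟨τ', mτ', l1, l2, l3⟩ := hz.1 d (by rw [← hd]; exact image_mono k1)
      obtain ⟨ρ', m, n1, n2, n3, n4⟩ := push σ σ' τ τ' ρ hr k1 l1 h1 mτ mτ' mρ (hd.trans l2.symm)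
        (k2.trans ha.symm) y z k3 h3 l3
      exact ⟨ρ', m, n1, n2.trans h2, n4⟩
    · intro a ha
      obtain ⟨τ', mτ', l1, l2, l3⟩ := hz.2 a (by rwa [hr])
      obtain ⟨d, hd⟩ := SGfin_fin_dom mτ'
      obtain ⟨τ, mτ, k1, k2, k3⟩ := hy.1 d (by rw [← hd]; exact image_mono l1)
      obtain ⟨c, hc⟩ := SGfin_fin_rng mτ
      obtain ⟨ρ, mρ, h1, h2, h3⟩ := hy'.2 c (by rw [← hc, ← hr]; exact image_mono k1)
      obtain ⟨ρ', m, n1, n2, n3, n4⟩ := push σ σ' τ τ' ρ hr k1 l1 h1 mτ mτ' mρ (k2.trans hd.symm)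
        (hc.trans h2.symm) y z k3 h3 l3
      exact ⟨ρ', m, n1, n3.trans l2, n4⟩
  · intro β hβ ih σ σ' hr y hy hy' z hz
    rw [mem_limit_iff β hβ] at *
    intro γ h1 h2
    exact ih γ h2 h1 σ σ' hr y (hy γ h1 h2) (hy' γ h1 h2) (hz γ h1 h2)

theorem Bset_eq (hbasis : TopologicalSpace.IsTopologicalBasis (Set.range A)) (x : X)
    (β : Ordinal.{0}) (hβ : 1 ≤ β) (σ σ' : Set (ℕ × ℕ)) (hr : prng σ = prng σ') (y : X)
    (h : y ∈ Bset G A β σ x) (h' : y ∈ Bset G A β σ' x) :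
    Bset G A β σ x = Bset G A β σ' x :=
  Subset.antisymm (Bset_sub hbasis x β hβ σ σ' hr y h h')
    (Bset_sub hbasis x β hβ σ' σ hr.symm y h' h)

end

theorem IsGdelta_polish {Y : Type*} [TopologicalSpace Y] [PolishSpace Y] {s : Set Y}
    (hs : IsGδ s) : PolishSpace s := by
  obtain ⟨f, hf, rfl⟩ := hs.eq_iInter_nat
  have : ∀ n, PolishSpace (f n) := fun n => (hf n).polishSpace
  let φ : (⋂ n, f n : Set Y) → ∀ n, f n := fun y n => ⟨y.1, mem_iInter.1 y.2 n⟩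
  have hφ : Continuous φ := by fun_prop
  have hind : Topology.IsInducing φ := by
    have h2 : Topology.IsInducing ((fun p : ∀ n, f n => (p 0 : Y)) ∘ φ) :=
      Topology.IsInducing.subtypeVal
    exact Topology.IsInducing.of_comp hφ (by fun_prop) h2
  have hinj : Function.Injective φ := by
    intro a b h
    have := congrArg (fun p : ∀ n, f n => (p 0 : Y)) h
    exact Subtype.ext this
  have hrange : range φ = ⋂ n, {p | (p n : Y) = p 0} := by
    ext p
    simp only [mem_range, mem_iInter]
    constructor
    · rintro ⟨y, rfl⟩ n; rfl
    · intro h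
      refine ⟨⟨p 0, mem_iInter.2 fun n => ?_⟩, ?_⟩
      · have e : (p n : Y) = p 0 := h n
        rw [← e]; exact (p n).2
      · funext n
        exact Subtype.ext (h n).symm
  have hcl : Topology.IsClosedEmbedding φ := by
    refine ⟨⟨hind, hinj⟩, ?_⟩
    rw [hrange]
    exact isClosed_iInter fun n => isClosed_eq (by fun_prop) (by fun_prop)
  exact hcl.polishSpace

open Classical in
theorem traceTop_polish {X : Type*} [TopologicalSpace X] [PolishSpace X] {A : ℕ → Set X}
    (hbasis : TopologicalSpace.IsTopologicalBasis (Set.range A)) {ι : Type*} [Countable ι]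
    (C : ι → Set X) (S : Set X) (F : Set (Set X)) (hF : F = range A ∪ range C)
    (hclopen : ∀ i, ∀ y ∈ S, y ∉ C i → ∃ j, y ∈ C j ∧ C j ∩ C i = ∅)
    (hG : IsGδ {p : X × (ι → Bool) | p.1 ∈ S ∧ ∀ i, p.2 i = true ↔ p.1 ∈ C i}) :
    @PolishSpace S (traceTop S F) := by
  set T := {p : X × (ι → Bool) | p.1 ∈ S ∧ ∀ i, p.2 i = true ↔ p.1 ∈ C i} with hT
  have hpi := @TopologicalSpace.IsCompletelyMetrizableSpace.pi_countable ι _ (fun _ => Bool) _ _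
  have hpol : PolishSpace (ι → Bool) := {}
  have := IsGdelta_polish hG
  let e : S ≃ T :=
    { toFun := fun y => ⟨(y.1, fun i => decide (y.1 ∈ C i)), y.2, fun i => by simp⟩
      invFun := fun p => ⟨p.1.1, p.2.1⟩
      left_inv := fun y => rfl
      right_inv := by
        rintro ⟨⟨y, s⟩, h1, h2⟩
        apply Subtype.ext
        refine Prod.ext rfl ?_
        funext i
        have := h2 i
        simp only at this
        simp only [← this]
        simp }
  have key : traceTop S F = TopologicalSpace.induced e inferInstance := by
    apply le_antisymm
    · rw [← continuous_iff_le_induced]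
      letI : TopologicalSpace S := traceTop S F
      have hopen : ∀ B ∈ F, IsOpen (Subtype.val ⁻¹' B : Set S) := fun B hB =>
        TopologicalSpace.isOpen_generateFrom_of_mem ⟨B, hB, rfl⟩
      refine Continuous.subtype_mk (Continuous.prodMk ?_ (continuous_pi fun i => ?_)) _
      · rw [hbasis.continuous_iff]
        rintro _ ⟨l, rfl⟩
        exact hopen _ (hF ▸ Or.inl ⟨l, rfl⟩)
      · rw [continuous_bool_rng true]
        have e1 : ((fun y : S => decide (y.1 ∈ C i)) ⁻¹' {true}) = Subtype.val ⁻¹' C i := by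
          ext y; simp
        rw [e1]
        refine ⟨⟨?_⟩, hopen _ (hF ▸ Or.inr ⟨i, rfl⟩)⟩
        rw [isOpen_iff_forall_mem_open]
        intro y hy
        obtain ⟨j, h1, h2⟩ := hclopen i y.1 y.2 hy
        refine ⟨_, ?_, hopen _ (hF ▸ Or.inr ⟨j, rfl⟩), h1⟩
        intro z hz hz'
        exact (h2 ▸ ⟨hz, hz'⟩ : z.1 ∈ (∅ : Set X))
    · apply le_generateFrom
      rintro _ ⟨B, hB, rfl⟩
      rw [hF] at hB
      rw [isOpen_induced_iff]
      rcases hB with ⟨l, rfl⟩ | ⟨i, rfl⟩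
      · refine ⟨{p : T | p.1.1 ∈ A l}, ?_, rfl⟩
        exact (hbasis.isOpen ⟨l, rfl⟩).preimage (by fun_prop : Continuous fun p : T => p.1.1)
      · refine ⟨{p : T | p.1.2 i = true}, ?_, ?_⟩
        · exact (isOpen_discrete {true}).preimage (by fun_prop : Continuous fun p : T => p.1.2 i)
        · ext y
          exact decide_eq_true_iff
  rw [key]
  exact e.polishSpace_induced

theorem countable_Iio_of_card {α : Ordinal.{0}} (hαc : α.card ≤ Cardinal.aleph0) :
    (Set.Iio α).Countable := by
  rw [← Cardinal.le_aleph0_iff_set_countable, Cardinal.mk_Iio_ordinal]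
  rw [Cardinal.lift_le_aleph0]
  exact hαc

section

variable {G : Subgroup Sinf} {X : Type*} [TopologicalSpace X] [PolishSpace X] [MulAction G X]
  [ContinuousSMul G X] {A : ℕ → Set X}

/-- The index type of the new basic sets. -/
abbrev Idx (G : Subgroup Sinf) (α : Ordinal.{0}) : Type 1 :=
  {p : Ordinal.{0} × Set (ℕ × ℕ) // (1 ≤ p.1 ∧ p.1 < α) ∧ p.2 ∈ SGfin G}

theorem Idx_countable (G : Subgroup Sinf) {α : Ordinal.{0}} (hαc : α.card ≤ Cardinal.aleph0) :
    Countable (Idx G α) := by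
  have := ((countable_Iio_of_card hαc).prod (SGfin_countable G))
  have h : {p : Ordinal.{0} × Set (ℕ × ℕ) | (1 ≤ p.1 ∧ p.1 < α) ∧ p.2 ∈ SGfin G}.Countable :=
    Set.Countable.mono (s₂ := Set.Iio α ×ˢ SGfin G) (fun p hp => ⟨hp.1.2, hp.2⟩) this
  exact h.to_subtype

theorem Bset_one_Gdelta (hbasis : TopologicalSpace.IsTopologicalBasis (Set.range A))
    (σ : Set (ℕ × ℕ)) (x : X) : IsGδ (Bset G A 1 σ x) := by
  have hop : ∀ l, IsOpen (setSmul G (Vc G (prng σ)) (A l)) := fun l =>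
    isOpen_biUnion fun g _ => (hbasis.isOpen (mem_range_self l)).smul g
  rw [Bset_one]
  refine IsGδ.inter ?_ ?_
  · exact .iInter fun l => .iInter fun _ => (hop l).isGδ
  · exact .iInter fun l => .iInter fun _ => (hop l).isClosed_compl.isGδ

theorem exists_K (hbasis : TopologicalSpace.IsTopologicalBasis (Set.range A)) (x : X)
    (α : Ordinal.{0}) (hαc : α.card ≤ Cardinal.aleph0) :
    ∀ β, 1 ≤ β → β ≤ α → ∀ σ ∈ SGfin G, ∃ K : Set (X × (Idx G α → Bool)), IsGδ K ∧
      ∀ p : X × (Idx G α → Bool),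
        (∀ i : Idx G α, i.1.1 < β → (p.2 i = true ↔ p.1 ∈ Bset G A i.1.1 i.1.2 x)) →
        (p ∈ K ↔ p.1 ∈ Bset G A β σ x) := by
  have hcount := Idx_countable G hαc
  have hO : ∀ i : Idx G α, IsOpen {p : X × (Idx G α → Bool) | p.2 i = true} := fun i =>
    (isOpen_discrete {true}).preimage
      (by fun_prop : Continuous fun p : X × (Idx G α → Bool) => p.2 i)
  apply ord_ind
  · intro _ σ _
    exact ⟨Prod.fst ⁻¹' Bset G A 1 σ x, (Bset_one_Gdelta hbasis σ x).preimage continuous_fst,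
      fun p _ => Iff.rfl⟩
  · intro β hβ _ hβα σ _
    have hlt : β < α := Order.add_one_le_iff.1 hβα
    refine ⟨(⋂ b : Finset ℕ, ⋂ (_ : pdom σ ⊆ ↑b), ⋃ i : Idx G α, ⋃ (_ : i.1.1 = β ∧
        σ ⊆ i.1.2 ∧ pdom i.1.2 = ↑b), {p | p.2 i = true}) ∩
      (⋂ b : Finset ℕ, ⋂ (_ : prng σ ⊆ ↑b), ⋃ i : Idx G α, ⋃ (_ : i.1.1 = β ∧
        σ ⊆ i.1.2 ∧ prng i.1.2 = ↑b), {p | p.2 i = true}), ?_, ?_⟩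
    · refine IsGδ.inter ?_ ?_
      · exact .iInter fun l => .iInter fun _ =>
          (isOpen_iUnion fun i => isOpen_iUnion fun _ => hO i).isGδ
      · exact .iInter fun l => .iInter fun _ =>
          (isOpen_iUnion fun i => isOpen_iUnion fun _ => hO i).isGδ
    · intro p hp
      have aux : ∀ Q : Set (ℕ × ℕ) → Prop,
          (∃ i : Idx G α, (i.1.1 = β ∧ σ ⊆ i.1.2 ∧ Q i.1.2) ∧ p.2 i = true) ↔
          ∃ σ' ∈ SGfin G, σ ⊆ σ' ∧ Q σ' ∧ p.1 ∈ Bset G A β σ' x := by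
        intro Q
        constructor
        · rintro ⟨⟨⟨γ, τ⟩, ⟨h1, h2⟩, h3⟩, ⟨h4, h5, h6⟩, h7⟩
          simp only at h4 h5 h6
          subst h4
          exact ⟨τ, h3, h5, h6, (hp _ (Order.lt_add_one_iff.2 le_rfl)).1 h7⟩
        · rintro ⟨τ, h3, h5, h6, h7⟩
          exact ⟨⟨⟨β, τ⟩, ⟨hβ, hlt⟩, h3⟩, ⟨rfl, h5, h6⟩,
            (hp _ (Order.lt_add_one_iff.2 le_rfl)).2 h7⟩
      rw [mem_succ_iff β hβ]
      simp only [mem_inter_iff, mem_iInter, mem_iUnion, exists_prop]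
      refine and_congr ?_ ?_
      · exact forall_congr' fun b => imp_congr Iff.rfl (aux fun τ => pdom τ = ↑b)
      · exact forall_congr' fun b => imp_congr Iff.rfl (aux fun τ => prng τ = ↑b)
  · intro β hβ _ hβα σ hσ
    refine ⟨⋂ i : Idx G α, ⋂ (_ : i.1.1 < β ∧ i.1.2 = σ), {p | p.2 i = true}, ?_, ?_⟩
    · exact .iInter fun i => .iInter fun _ => (hO i).isGδ
    · intro p hp
      rw [mem_limit_iff β hβ]
      simp only [mem_iInter]
      constructor
      · intro h γ h1 h2
        exact (hp ⟨(γ, σ), ⟨h2, h1.trans_le hβα⟩, hσ⟩ h1).1 (h _ ⟨h1, rfl⟩)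
      · rintro h ⟨⟨γ, τ⟩, ⟨h1, h2⟩, h3⟩ ⟨h4, h5⟩
        simp only at h4 h5
        subst h5
        exact (hp _ h4).2 (h γ h4 h1)

theorem empty_mem_SGfin (G : Subgroup Sinf) : (∅ : Set (ℕ × ℕ)) ∈ SGfin G := by
  refine ⟨1, G.one_mem, ∅, ?_⟩
  ext p
  simp [restr]

theorem cover (x : X) (α : Ordinal.{0}) (hα : 1 ≤ α) (y : X) (hy : y ∈ Bset G A α ∅ x)
    (i : Idx G α) : ∃ j : Idx G α, j.1.1 = i.1.1 ∧ prng j.1.2 = prng i.1.2 ∧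
      y ∈ Bset G A j.1.1 j.1.2 x := by
  obtain ⟨⟨γ, τ⟩, ⟨h1, h2⟩, h3⟩ := i
  have h4 : y ∈ Bset G A (γ + 1) ∅ x :=
    Bset_mono (empty_mem_SGfin G) x (h1.trans (Order.lt_add_one_iff.2 le_rfl).le) α hα
      (Order.add_one_le_iff.2 h2) hy
  rw [mem_succ_iff γ h1] at h4
  obtain ⟨a, ha⟩ := SGfin_fin_rng h3
  obtain ⟨σ, m, _, k1, k2⟩ := h4.2 a (by simp [prng])
  exact ⟨⟨(γ, σ), ⟨h1, h2⟩, m⟩, rfl, k1.trans ha.symm, k2⟩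

theorem image_Gdelta (hbasis : TopologicalSpace.IsTopologicalBasis (Set.range A)) (x : X)
    (α : Ordinal.{0}) (hα : 1 ≤ α) (hαc : α.card ≤ Cardinal.aleph0) :
    IsGδ {p : X × (Idx G α → Bool) | p.1 ∈ Bset G A α ∅ x ∧
      ∀ i, p.2 i = true ↔ p.1 ∈ Bset G A i.1.1 i.1.2 x} := by
  have hcount := Idx_countable G hαc
  have hc : ∀ i : Idx G α, Continuous fun p : X × (Idx G α → Bool) => p.2 i := fun i => by
    fun_prop
  have hK := exists_K (G := G) hbasis x α hαc
  obtain ⟨K₀, hK₀, hK₀'⟩ := hK α hα le_rfl ∅ (empty_mem_SGfin G)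
  have hK' : ∀ i : Idx G α, ∃ K : Set (X × (Idx G α → Bool)), IsGδ K ∧
      ∀ p : X × (Idx G α → Bool),
        (∀ j : Idx G α, j.1.1 < i.1.1 → (p.2 j = true ↔ p.1 ∈ Bset G A j.1.1 j.1.2 x)) →
        (p ∈ K ↔ p.1 ∈ Bset G A i.1.1 i.1.2 x) := fun i =>
    hK i.1.1 i.2.1.1 i.2.1.2.le i.1.2 i.2.2
  choose K hKG hKm using hK'
  have heq : {p : X × (Idx G α → Bool) | p.1 ∈ Bset G A α ∅ x ∧
      ∀ i, p.2 i = true ↔ p.1 ∈ Bset G A i.1.1 i.1.2 x} =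
      ((⋂ i, ({p | p.2 i = false} ∪ K i)) ∩
      (⋂ i : Idx G α, ⋃ j : Idx G α, ⋃ (_ : j.1.1 = i.1.1 ∧ prng j.1.2 = prng i.1.2),
        {p | p.2 j = true})) ∩
      ((⋂ i : Idx G α, ⋂ j : Idx G α, ⋂ (_ : Bset G A i.1.1 i.1.2 x = Bset G A j.1.1 j.1.2 x),
        {p | p.2 i = p.2 j}) ∩ K₀) := by
    ext p
    simp only [mem_inter_iff, mem_iInter, mem_iUnion, exists_prop, mem_union]
    constructor
    · rintro ⟨h1, h2⟩
      refine ⟨⟨fun i => ?_, fun i => ?_⟩, fun i j h => ?_, ?_⟩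
      · by_cases h : p.2 i = true
        · exact Or.inr ((hKm i p fun j _ => h2 j).2 ((h2 i).1 h))
        · exact Or.inl (by simpa using h)
      · obtain ⟨j, k1, k2, k3⟩ := cover x α hα p.1 h1 i
        exact ⟨j, ⟨k1, k2⟩, (h2 j).2 k3⟩
      · change p.2 i = p.2 j
        rw [Bool.eq_iff_iff, h2 i, h2 j, h]
      · exact (hK₀' p fun j _ => h2 j).2 h1
    · rintro ⟨⟨h1, h2⟩, h3, h4⟩
      have main : ∀ β : Ordinal.{0}, ∀ i : Idx G α, i.1.1 = β →
          (p.2 i = true ↔ p.1 ∈ Bset G A i.1.1 i.1.2 x) := by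
        intro β
        induction β using WellFoundedLT.induction with
        | ind β ih =>
          have fwd : ∀ i : Idx G α, i.1.1 = β → p.2 i = true →
              p.1 ∈ Bset G A i.1.1 i.1.2 x := by
            intro i hi h
            rcases h1 i with h' | h'
            · have h' : p.2 i = false := h'
              simp [h'] at h
            · exact (hKm i p fun j hj => ih j.1.1 (hi ▸ hj) j rfl).1 h'
          intro i hi
          refine ⟨fwd i hi, fun h => ?_⟩
          obtain ⟨j, ⟨k1, k2⟩, k3⟩ := h2 i
          have h5 := fwd j (k1.trans hi) k3
          have h6 : Bset G A i.1.1 i.1.2 x = Bset G A j.1.1 j.1.2 x := by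
            rw [k1] at h5 ⊢
            exact Bset_eq hbasis x i.1.1 i.2.1.1 _ _ k2.symm p.1 h h5
          have h7 : p.2 i = p.2 j := h3 i j h6
          rw [h7]
          exact k3
      have main' := fun i => main _ i rfl
      exact ⟨(hK₀' p fun j _ => main' j).1 h4, main'⟩
  rw [heq]
  refine IsGδ.inter (IsGδ.inter ?_ ?_) (IsGδ.inter ?_ hK₀)
  · exact .iInter fun i => IsGδ.union ((isOpen_discrete {false}).preimage (hc i)).isGδ (hKG i)
  · exact .iInter fun i => (isOpen_iUnion fun j => isOpen_iUnion fun _ =>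
      (isOpen_discrete {true}).preimage (hc j)).isGδ
  · exact .iInter fun i => .iInter fun j => .iInter fun _ =>
      ((isOpen_discrete {q : Bool × Bool | q.1 = q.2}).preimage ((hc i).prodMk (hc j))).isGδ

theorem BltFam_eq (x : X) (α : Ordinal.{0}) :
    BltFam G A x α = range A ∪ range (fun i : Idx G α => Bset G A i.1.1 i.1.2 x) := by
  ext B
  constructor
  · rintro (⟨l, rfl⟩ | ⟨β, h1, h2, σ, h3, rfl⟩)
    · exact Or.inl ⟨l, rfl⟩
    · exact Or.inr ⟨⟨(β, σ), ⟨h1, h2⟩, h3⟩, rfl⟩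
  · rintro (⟨l, rfl⟩ | ⟨⟨⟨β, σ⟩, ⟨h1, h2⟩, h3⟩, rfl⟩)
    · exact Or.inl ⟨l, rfl⟩
    · exact Or.inr ⟨β, h1, h2, σ, h3, rfl⟩

theorem polish_part (hbasis : TopologicalSpace.IsTopologicalBasis (Set.range A)) (x : X)
    (α : Ordinal.{0}) (hα : 1 ≤ α) (hαc : α.card ≤ Cardinal.aleph0) :
    @PolishSpace ↥(Bset G A α (∅ : Set (ℕ × ℕ)) x)
      (traceTop (Bset G A α (∅ : Set (ℕ × ℕ)) x) (BltFam G A x α)) := by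
  have hcount := Idx_countable G hαc
  refine traceTop_polish hbasis (fun i : Idx G α => Bset G A i.1.1 i.1.2 x) _ _
    (BltFam_eq x α) ?_ (image_Gdelta hbasis x α hα hαc)
  intro i y hy hi
  obtain ⟨j, k1, k2, k3⟩ := cover x α hα y hy i
  refine ⟨j, k3, ?_⟩
  rw [← not_nonempty_iff_eq_empty]
  rintro ⟨z, hz1, hz2⟩
  apply hi
  rw [k1] at hz1 k3
  rw [Bset_eq hbasis x i.1.1 i.2.1.1 _ _ k2.symm z hz2 hz1]
  exact k3

theorem isOpen_agree (G : Subgroup Sinf) (g : G) (c : Finset ℕ) :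
    IsOpen {h : G | ∀ k ∈ c, (h : Sinf) k = (g : Sinf) k} := by
  have : {h : G | ∀ k ∈ c, (h : Sinf) k = (g : Sinf) k} =
      ⋂ k ∈ c, (fun h : G => (h : Sinf) k) ⁻¹' {(g : Sinf) k} := by
    ext h; simp
  rw [this]
  refine isOpen_biInter_finset fun k _ => ?_
  have h1 : Continuous (fun f : Sinf => (f : ℕ → ℕ)) := continuous_induced_dom
  have h2 : Continuous (fun h : G => (h : Sinf) k) :=
    (continuous_apply k).comp (h1.comp continuous_subtype_val)
  exact (isOpen_discrete _).preimage h2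

end

end Proof

/-- Polishness of the refined topology on an α-set. -/
theorem refined_topology_polish
    (G : Subgroup Sinf) (hGclosed : IsClosed (G : Set Sinf))
    {X : Type*} [TopologicalSpace X] [PolishSpace X] [MulAction G X] [ContinuousSMul G X]
    (A : ℕ → Set X) (hbasis : TopologicalSpace.IsTopologicalBasis (Set.range A))
    (hbasisInv : ∀ l, ∃ c : Finset ℕ, ∀ g ∈ Vc G (↑c : Set ℕ), g • A l = A l)
    (x : X) (α : Ordinal.{0}) (hα : 1 ≤ α) (hαc : α.card ≤ Cardinal.aleph0) :
    @PolishSpace ↥(Bset G A α (∅ : Set (ℕ × ℕ)) x)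
      (traceTop (Bset G A α (∅ : Set (ℕ × ℕ)) x) (BltFam G A x α)) ∧
    ∃ hinv : ∀ (g : G) (y : X), y ∈ Bset G A α (∅ : Set (ℕ × ℕ)) x →
        g • y ∈ Bset G A α (∅ : Set (ℕ × ℕ)) x,
      @Continuous (G × ↥(Bset G A α (∅ : Set (ℕ × ℕ)) x)) ↥(Bset G A α (∅ : Set (ℕ × ℕ)) x)
        (@instTopologicalSpaceProd _ _ _
          (traceTop (Bset G A α (∅ : Set (ℕ × ℕ)) x) (BltFam G A x α)))
        (traceTop (Bset G A α (∅ : Set (ℕ × ℕ)) x) (BltFam G A x α))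
        (fun p => ⟨p.1 • (p.2 : X), hinv p.1 p.2 p.2.2⟩) := by
  have hempty : ∀ f : Sinf, compL f (∅ : Set (ℕ × ℕ)) = ∅ := fun f => by
    ext p; exact Iff.rfl
  refine ⟨polish_part hbasis x α hα hαc, fun g y hy => ?_, ?_⟩
  · have := Bset_smul hbasis x α hα g ∅ y hy
    rwa [hempty] at this
  · letI tS : TopologicalSpace ↥(Bset G A α (∅ : Set (ℕ × ℕ)) x) :=
      traceTop (Bset G A α (∅ : Set (ℕ × ℕ)) x) (BltFam G A x α)
    have hopen : ∀ B ∈ BltFam G A x α,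
        IsOpen (Subtype.val ⁻¹' B : Set ↥(Bset G A α (∅ : Set (ℕ × ℕ)) x)) := fun B hB =>
      TopologicalSpace.isOpen_generateFrom_of_mem ⟨B, hB, rfl⟩
    have hval : Continuous (Subtype.val : ↥(Bset G A α (∅ : Set (ℕ × ℕ)) x) → X) := by
      rw [hbasis.continuous_iff]
      rintro _ ⟨l, rfl⟩
      exact hopen _ (Or.inl ⟨l, rfl⟩)
    refine continuous_generateFrom_iff.2 ?_
    rintro _ ⟨B, hB, rfl⟩
    rcases hB with ⟨l, rfl⟩ | ⟨β, h1, h2, σ, h3, rfl⟩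
    · have hc : Continuous (fun p : G × ↥(Bset G A α (∅ : Set (ℕ × ℕ)) x) => p.1 • (p.2 : X)) :=
        continuous_fst.smul (hval.comp continuous_snd)
      exact (hbasis.isOpen ⟨l, rfl⟩).preimage hc
    · rw [isOpen_iff_forall_mem_open]
      rintro ⟨g, y⟩ hgy
      have hgy : g • (y : X) ∈ Bset G A β σ x := hgy
      obtain ⟨c, hc⟩ := SGfin_fin_rng (compL_mem (G.inv_mem g.2) h3)
      have hback : ∀ h : G, (∀ k ∈ c, (h : Sinf) k = (g : Sinf) k) →
          compL (h : Sinf) (compL (g : Sinf)⁻¹ σ) = σ := by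
        intro h hh
        rw [compL_congr (g := (g : Sinf)) (by rw [hc]; exact hh)]
        simpa using compL_inv (g : Sinf)⁻¹ σ
      refine ⟨{h : G | ∀ k ∈ c, (h : Sinf) k = (g : Sinf) k} ×ˢ
        (Subtype.val ⁻¹' Bset G A β (compL (g : Sinf)⁻¹ σ) x), ?_, ?_, ?_, ?_⟩
      · rintro ⟨h, z⟩ ⟨hh, hz⟩
        have := Bset_smul hbasis x β h1 h _ _ hz
        rw [hback h hh] at this
        exact this
      · exact (isOpen_agree G g c).prod
          (hopen _ (Or.inr ⟨β, h1, h2, _, compL_mem (G.inv_mem g.2) h3, rfl⟩))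
      · intro k _; rfl
      · have := Bset_smul hbasis x β h1 g⁻¹ _ _ hgy
        simpa using this
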